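/- arXiv:math/0511073 — 2 statements merged into one kernel-verified Lean document; each statement's English description precedes it below -/
import Mathlib

section
/- Let N ≥ 1, let {(x_i, y_i, z_i) ∈ ℝ³ : i = 0, 1, …, N} be given with x₀ < x₁ < ⋯ < x_N, and for each i = 1, …, N let L_i : [x₀, x_N] → [x_{i−1}, x_i] be the increasing affine map with L_i(x₀) = x_{i−1}, L_i(x_N) = x_i, and let F_i(x, y, z) = (α_i y + β_i z + p_i(x), γ_i z + q_i(x)) where |α_i| < 1, |β_i| + |γ_i| < 1, p_i, q_i : [x₀, x_N] → ℝ are continuous, and the matching conditions F_i(x₀, y₀, z₀) = (y_{i−1}, z_{i−1}) and F_i(x_N, y_N, z_N) = (y_i, z_i) hold. Then there exists exactly one continuous function f = (f₁, f₂) : [x₀, x_N] → ℝ² such that f(L_i(x)) = F_i(x, f₁(x), f₂(x)) for all x ∈ [x₀, x_N] and all i = 1, …, N; moreover this f satisfies f(x_i) = (y_i, z_i) for every i = 0, 1, …, N. -/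
/-- The affine map taking `[x 0, x N]` onto `[x i, x (i + 1)]`. -/
noncomputable def cellMap (x : ℕ → ℝ) (N i : ℕ) (t : ℝ) : ℝ :=
  x i + (x (i + 1) - x i) / (x N - x 0) * (t - x 0)

/-- The inverse of `cellMap x N i`. -/
noncomputable def cellInv (x : ℕ → ℝ) (N i : ℕ) (t : ℝ) : ℝ :=
  x 0 + (x N - x 0) / (x (i + 1) - x i) * (t - x i)

/-- The Read–Bajraktarević operator of the maps `(t, u) ↦ a i * u + r i t`, written as a sum of
increments over the cells. -/
noncomputable def readBajraktarevic (N : ℕ) (x w a : ℕ → ℝ) (r : ℕ → ℝ → ℝ)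
    (h : x 0 ≤ x N) (G : ℝ → ℝ) (t : ℝ) : ℝ :=
  w 0 + ∑ i ∈ Finset.range N,
    ((a i * G (Set.projIcc (x 0) (x N) h (cellInv x N i t)) +
        r i (Set.projIcc (x 0) (x N) h (cellInv x N i t))) -
      (a i * G (x 0) + r i (x 0)))

section Partition

variable {N : ℕ} {x : ℕ → ℝ}

lemma partition_le (hx : ∀ i < N, x i < x (i + 1)) {i j : ℕ} (hij : i ≤ j) (hj : j ≤ N) :
    x i ≤ x j := by
  induction j, hij using Nat.le_induction with
  | base => exact le_rfl
  | succ k hk ih => exact (ih (by omega)).trans (hx k (by omega)).le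

lemma partition_lt (hx : ∀ i < N, x i < x (i + 1)) {i j : ℕ} (hij : i < j) (hj : j ≤ N) :
    x i < x j :=
  (hx i (by omega)).trans_le (partition_le hx hij hj)

lemma cellInv_cellMap {i : ℕ} (h0 : x 0 < x N) (hi : x i < x (i + 1)) (t : ℝ) :
    cellInv x N i (cellMap x N i t) = t := by
  have h1 : x N - x 0 ≠ 0 := (sub_pos.2 h0).ne'
  have h2 : x (i + 1) - x i ≠ 0 := (sub_pos.2 hi).ne'
  unfold cellInv cellMap
  field_simp
  ring

lemma cellMap_cellInv {i : ℕ} (h0 : x 0 < x N) (hi : x i < x (i + 1)) (t : ℝ) :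
    cellMap x N i (cellInv x N i t) = t := by
  have h1 : x N - x 0 ≠ 0 := (sub_pos.2 h0).ne'
  have h2 : x (i + 1) - x i ≠ 0 := (sub_pos.2 hi).ne'
  unfold cellInv cellMap
  field_simp
  ring

lemma cellMap_left (i : ℕ) : cellMap x N i (x 0) = x i := by simp [cellMap]

lemma cellMap_right {i : ℕ} (h0 : x 0 < x N) : cellMap x N i (x N) = x (i + 1) := by
  have h1 : x N - x 0 ≠ 0 := (sub_pos.2 h0).ne'
  unfold cellMap
  field_simp
  ring

lemma cellMap_mono {i : ℕ} (h0 : x 0 < x N) (hi : x i < x (i + 1)) :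
    Monotone (cellMap x N i) := fun s t hst => by
  have h1 : 0 ≤ (x (i + 1) - x i) / (x N - x 0) := by
    have := sub_pos.2 h0
    have := sub_pos.2 hi
    positivity
  unfold cellMap
  gcongr

lemma cellInv_mono {i : ℕ} (h0 : x 0 < x N) (hi : x i < x (i + 1)) :
    Monotone (cellInv x N i) := fun s t hst => by
  have h1 : 0 ≤ (x N - x 0) / (x (i + 1) - x i) := by
    have := sub_pos.2 h0
    have := sub_pos.2 hi
    positivity
  unfold cellInv
  gcongr

lemma cellInv_left (i : ℕ) : cellInv x N i (x i) = x 0 := by simp [cellInv]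

lemma cellInv_right {i : ℕ} (hi : x i < x (i + 1)) : cellInv x N i (x (i + 1)) = x N := by
  have h1 : x (i + 1) - x i ≠ 0 := (sub_pos.2 hi).ne'
  unfold cellInv
  field_simp
  ring

lemma cellMap_mem (hx : ∀ i < N, x i < x (i + 1)) {i : ℕ} (hi : i < N) {t : ℝ}
    (ht : t ∈ Set.Icc (x 0) (x N)) : cellMap x N i t ∈ Set.Icc (x i) (x (i + 1)) := by
  have h0 : x 0 < x N := partition_lt hx (by omega) le_rfl
  have hm := cellMap_mono h0 (hx i hi)
  have h1 := hm ht.1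
  have h2 := hm ht.2
  rw [cellMap_left] at h1
  rw [cellMap_right h0] at h2
  exact ⟨h1, h2⟩

lemma exists_mem_cell {t : ℝ} (hN : 1 ≤ N) (ht : t ∈ Set.Icc (x 0) (x N)) :
    ∃ i < N, t ∈ Set.Icc (x i) (x (i + 1)) := by
  induction N, hN using Nat.le_induction with
  | base => exact ⟨0, one_pos, ht⟩
  | succ k hk ih =>
    rcases le_total t (x k) with h | h
    · obtain ⟨i, hi, hti⟩ := ih ⟨ht.1, h⟩
      exact ⟨i, by omega, hti⟩
    · exact ⟨k, by omega, h, ht.2⟩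

lemma exists_eq_cellMap (hx : ∀ i < N, x i < x (i + 1)) (hN : 1 ≤ N) {t : ℝ}
    (ht : t ∈ Set.Icc (x 0) (x N)) :
    ∃ i < N, ∃ s ∈ Set.Icc (x 0) (x N), cellMap x N i s = t := by
  have h0 : x 0 < x N := partition_lt hx (by omega) le_rfl
  obtain ⟨i, hi, hti⟩ := exists_mem_cell hN ht
  have hm := cellInv_mono h0 (hx i hi)
  have h1 := hm hti.1
  have h2 := hm hti.2
  rw [cellInv_left] at h1
  rw [cellInv_right (hx i hi)] at h2
  exact ⟨i, hi, _, ⟨h1, h2⟩, cellMap_cellInv h0 (hx i hi) t⟩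

end Partition

section Scalar

variable {N : ℕ} {x w a : ℕ → ℝ} {r : ℕ → ℝ → ℝ}

lemma readBajraktarevic_cellMap (hx : ∀ i < N, x i < x (i + 1)) (h : x 0 ≤ x N)
    (hl : ∀ i < N, a i * w 0 + r i (x 0) = w i)
    (hr : ∀ i < N, a i * w N + r i (x N) = w (i + 1))
    {G : ℝ → ℝ} (hG0 : G (x 0) = w 0) (hGN : G (x N) = w N)
    {j : ℕ} (hj : j < N) {s : ℝ} (hs : s ∈ Set.Icc (x 0) (x N)) :
    readBajraktarevic N x w a r h G (cellMap x N j s) = a j * G s + r j s := by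
  have h0 : x 0 < x N := partition_lt hx (by omega) le_rfl
  have hmem := cellMap_mem hx hj hs
  have key : ∀ i ∈ Finset.range N,
      (a i * G (Set.projIcc (x 0) (x N) h (cellInv x N i (cellMap x N j s))) +
        r i (Set.projIcc (x 0) (x N) h (cellInv x N i (cellMap x N j s)))) -
      (a i * G (x 0) + r i (x 0)) =
      (fun k => if k ≤ j then w k else a j * G s + r j s) (i + 1) -
      (fun k => if k ≤ j then w k else a j * G s + r j s) i := by
    intro i hi
    rw [Finset.mem_range] at hi
    have hm := cellInv_mono h0 (hx i hi)
    rcases lt_trichotomy i j with hij | rfl | hij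
    · have h1 : x N ≤ cellInv x N i (cellMap x N j s) := by
        rw [← cellInv_right (N := N) (hx i hi)]
        exact hm ((partition_le hx hij hj.le).trans hmem.1)
      rw [Set.projIcc_of_right_le h h1]
      simp [hG0, hGN, hl i hi, hr i hi, hij.le, Nat.succ_le_of_lt hij]
    · rw [cellInv_cellMap h0 (hx i hi), Set.projIcc_of_mem h hs]
      simp [hG0, hl i hi]
    · have h1 : cellInv x N i (cellMap x N j s) ≤ x 0 := by
        rw [← cellInv_left (x := x) (N := N) i]
        exact hm (hmem.2.trans (partition_le hx hij hi.le))
      rw [Set.projIcc_of_le_left h h1]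
      have h2 : ¬ i + 1 ≤ j := by omega
      have h3 : ¬ i ≤ j := by omega
      simp only [h2, h3, if_false, sub_self]
  rw [readBajraktarevic, Finset.sum_congr rfl key,
    Finset.sum_range_sub fun k => if k ≤ j then w k else a j * G s + r j s]
  simp [hj]

lemma continuous_readBajraktarevic (h : x 0 ≤ x N)
    (hcont : ∀ i < N, ContinuousOn (r i) (Set.Icc (x 0) (x N)))
    {G : ℝ → ℝ} (hG : Continuous G) : Continuous (readBajraktarevic N x w a r h G) := by
  unfold readBajraktarevic
  refine continuous_const.add (continuous_finsetSum _ fun i hi => ?_)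
  have hc : Continuous fun t => (Set.projIcc (x 0) (x N) h (cellInv x N i t) : ℝ) := by
    refine continuous_subtype_val.comp (continuous_projIcc.comp ?_)
    unfold cellInv
    fun_prop
  refine (((hG.comp hc).const_mul _).add ?_).sub continuous_const
  exact (hcont i (Finset.mem_range.1 hi)).comp_continuous hc fun t => Subtype.coe_prop _

/-- Two continuous solutions of the same scalar self-referential equation agree. -/
lemma eqOn_of_selfReferential (hN : 1 ≤ N) (hx : ∀ i < N, x i < x (i + 1))
    (ha : ∀ i < N, |a i| < 1) {g f : ℝ → ℝ}
    (hg : ContinuousOn g (Set.Icc (x 0) (x N))) (hf : ContinuousOn f (Set.Icc (x 0) (x N)))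
    (hgr : ∀ i < N, ∀ t ∈ Set.Icc (x 0) (x N), g (cellMap x N i t) = a i * g t + r i t)
    (hfr : ∀ i < N, ∀ t ∈ Set.Icc (x 0) (x N), f (cellMap x N i t) = a i * f t + r i t) :
    Set.EqOn g f (Set.Icc (x 0) (x N)) := by
  have h0 : x 0 < x N := partition_lt hx (by omega) le_rfl
  obtain ⟨m, hm, hmax⟩ := isCompact_Icc.exists_isMaxOn (Set.nonempty_Icc.2 h0.le) (hg.sub hf).abs
  obtain ⟨i, hi, s, hs, hsm⟩ := exists_eq_cellMap hx hN hm
  have h1 : |g m - f m| = |a i| * |g s - f s| := by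
    rw [← hsm, hgr i hi s hs, hfr i hi s hs, ← abs_mul]
    ring_nf
  have h2 : |g s - f s| ≤ |g m - f m| := hmax hs
  have h3 : |g m - f m| ≤ 0 := by
    nlinarith [ha i hi, abs_nonneg (a i), abs_nonneg (g m - f m)]
  intro t ht
  have h4 : |g t - f t| ≤ |g m - f m| := hmax ht
  exact sub_eq_zero.1 (abs_nonpos_iff.1 (h4.trans h3))

/-- Existence of a continuous interpolating solution of a scalar self-referential equation. -/
lemma exists_selfReferential (hN : 1 ≤ N) (hx : ∀ i < N, x i < x (i + 1))
    (ha : ∀ i < N, |a i| < 1)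
    (hcont : ∀ i < N, ContinuousOn (r i) (Set.Icc (x 0) (x N)))
    (hl : ∀ i < N, a i * w 0 + r i (x 0) = w i)
    (hr : ∀ i < N, a i * w N + r i (x N) = w (i + 1)) :
    ∃ f : ℝ → ℝ, Continuous f ∧
      (∀ i < N, ∀ t ∈ Set.Icc (x 0) (x N), f (cellMap x N i t) = a i * f t + r i t) ∧
      ∀ i ≤ N, f (x i) = w i := by
  have h0 : x 0 < x N := partition_lt hx (by omega) le_rfl
  have hL : x 0 ∈ Set.Icc (x 0) (x N) := Set.left_mem_Icc.2 h0.le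
  have hR : x N ∈ Set.Icc (x 0) (x N) := Set.right_mem_Icc.2 h0.le
  let E := C(Set.Icc (x 0) (x N), ℝ)
  let ext : E → ℝ → ℝ := fun g => Set.IccExtend h0.le g
  have hext : ∀ (g : E) t (ht : t ∈ Set.Icc (x 0) (x N)), ext g t = g ⟨t, ht⟩ :=
    fun g t ht => Set.IccExtend_of_mem h0.le g ht
  have hextc : ∀ g : E, Continuous (ext g) := fun g => g.continuous.Icc_extend'
  let T : E → E := fun g =>
    ⟨fun t => readBajraktarevic N x w a r h0.le (ext g) t,
      (continuous_readBajraktarevic h0.le hcont (hextc g)).comp continuous_subtype_val⟩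
  let S : Set E := {g | g ⟨x 0, hL⟩ = w 0 ∧ g ⟨x N, hR⟩ = w N}
  have hTcell : ∀ g ∈ S, ∀ i < N, ∀ s ∈ Set.Icc (x 0) (x N),
      ∀ ht : cellMap x N i s ∈ Set.Icc (x 0) (x N),
        T g ⟨cellMap x N i s, ht⟩ = a i * ext g s + r i s := fun g hg i hi s hs _ =>
    readBajraktarevic_cellMap hx h0.le hl hr ((hext g _ hL).trans hg.1)
      ((hext g _ hR).trans hg.2) hi hs
  have hmem : ∀ i < N, ∀ s ∈ Set.Icc (x 0) (x N), cellMap x N i s ∈ Set.Icc (x 0) (x N) :=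
    fun i hi s hs => Set.Icc_subset_Icc (partition_le hx i.zero_le hi.le)
      (partition_le hx hi le_rfl) (cellMap_mem hx hi hs)
  have hmaps : Set.MapsTo T S S := by
    intro g hg
    constructor
    · have := hTcell g hg 0 (by omega) _ hL (hmem 0 (by omega) _ hL)
      simp only [cellMap_left, hext g _ hL, hg.1] at this
      exact this.trans (hl 0 (by omega))
    · have := hTcell g hg (N - 1) (by omega) _ hR (hmem _ (by omega) _ hR)
      simp only [cellMap_right h0, Nat.sub_add_cancel hN, hext g _ hR, hg.2] at this
      have h2 := hr (N - 1) (by omega)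
      rw [Nat.sub_add_cancel hN] at h2
      exact this.trans h2
  have hclosed : IsClosed S :=
    (isClosed_eq (continuous_eval_const _) continuous_const).inter
      (isClosed_eq (continuous_eval_const _) continuous_const)
  let K : NNReal := (Finset.range N).sup fun i => ‖a i‖₊
  have hK : K < 1 := (Finset.sup_lt_iff (by simp)).2 fun i hi => by
    rw [← NNReal.coe_lt_coe]
    simpa using ha i (Finset.mem_range.1 hi)
  have haK : ∀ i < N, |a i| ≤ K := fun i hi => by
    have : ‖a i‖₊ ≤ K := Finset.le_sup (f := fun i => ‖a i‖₊) (Finset.mem_range.2 hi)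
    simpa using NNReal.coe_le_coe.2 this
  have hcontr : ContractingWith K (hmaps.restrict T S S) := by
    refine ⟨hK, LipschitzWith.of_dist_le_mul fun g f => ?_⟩
    change dist (T g) (T f) ≤ K * dist g.1 f.1
    rw [ContinuousMap.dist_le (by positivity)]
    rintro ⟨t, ht⟩
    obtain ⟨i, hi, s, hs, rfl⟩ := exists_eq_cellMap hx hN ht
    rw [hTcell g g.2 i hi s hs, hTcell f f.2 i hi s hs, Real.dist_eq, add_sub_add_right_eq_sub,
      ← mul_sub, abs_mul, hext _ s hs, hext _ s hs]
    exact mul_le_mul (haK i hi) (ContinuousMap.dist_apply_le_dist (f := g.1) (g := f.1) ⟨s, hs⟩) (abs_nonneg _) K.2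
  let g₀ : E := ⟨fun t => w 0 + (w N - w 0) / (x N - x 0) * (t - x 0), by fun_prop⟩
  have hg₀ : g₀ ∈ S := by
    have h1 : x N - x 0 ≠ 0 := (sub_pos.2 h0).ne'
    constructor
    · change w 0 + (w N - w 0) / (x N - x 0) * (x 0 - x 0) = w 0
      simp
    · change w 0 + (w N - w 0) / (x N - x 0) * (x N - x 0) = w N
      rw [div_mul_cancel₀ _ h1, add_sub_cancel]
  obtain ⟨g, hg, hfix, -⟩ :=
    hcontr.exists_fixedPoint' hclosed.isComplete hmaps hg₀ (edist_ne_top _ _)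
  have heq : ∀ i < N, ∀ t ∈ Set.Icc (x 0) (x N),
      ext g (cellMap x N i t) = a i * ext g t + r i t := fun i hi t ht => by
    rw [← hTcell g hg i hi t ht (hmem i hi t ht), hfix.eq, hext]
  refine ⟨ext g, hextc g, heq, fun i hi => ?_⟩
  rcases hi.lt_or_eq with hi | rfl
  · have := heq i hi _ hL
    rwa [cellMap_left, hext g _ hL, hg.1, hl i hi] at this
  · exact (hext g _ hR).trans hg.2

end Scalar


/-- Existence and uniqueness of the vector-valued fractal interpolation function:
given interpolation data `(x i, y i, z i)`, `i = 0, …, N`, with strictly increasing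
abscissae, the affine maps `L i` and the maps
`F i (t, y, z) = (α i * y + β i * z + p i t, γ i * z + q i t)` satisfying the matching
conditions, there is exactly one continuous `f = (f₁, f₂)` on `[x 0, x N]` with
`f (L i t) = F i (t, f₁ t, f₂ t)`, and it interpolates the data. -/
theorem chfif_existence_uniqueness
    (N : ℕ) (hN : 1 ≤ N)
    (x y z : ℕ → ℝ)
    (hx : ∀ i < N, x i < x (i + 1))
    (α β γ : ℕ → ℝ)
    (hα : ∀ i ∈ Set.Icc 1 N, |α i| < 1)
    (hβγ : ∀ i ∈ Set.Icc 1 N, |β i| + |γ i| < 1)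
    (p q : ℕ → ℝ → ℝ)
    (hp : ∀ i ∈ Set.Icc 1 N, ContinuousOn (p i) (Set.Icc (x 0) (x N)))
    (hq : ∀ i ∈ Set.Icc 1 N, ContinuousOn (q i) (Set.Icc (x 0) (x N)))
    (L : ℕ → ℝ → ℝ)
    (hL : ∀ i ∈ Set.Icc 1 N, ∀ t : ℝ,
      L i t = x (i - 1) + (x i - x (i - 1)) / (x N - x 0) * (t - x 0))
    (hmatch0 : ∀ i ∈ Set.Icc 1 N,
      α i * y 0 + β i * z 0 + p i (x 0) = y (i - 1) ∧ γ i * z 0 + q i (x 0) = z (i - 1))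
    (hmatchN : ∀ i ∈ Set.Icc 1 N,
      α i * y N + β i * z N + p i (x N) = y i ∧ γ i * z N + q i (x N) = z i) :
    ∃ f : ℝ → ℝ × ℝ,
      (ContinuousOn f (Set.Icc (x 0) (x N)) ∧
        (∀ i ∈ Set.Icc 1 N, ∀ t ∈ Set.Icc (x 0) (x N),
          f (L i t) = (α i * (f t).1 + β i * (f t).2 + p i t, γ i * (f t).2 + q i t)) ∧
        (∀ i ≤ N, f (x i) = (y i, z i))) ∧
      ∀ g : ℝ → ℝ × ℝ,
        ContinuousOn g (Set.Icc (x 0) (x N)) →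
        (∀ i ∈ Set.Icc 1 N, ∀ t ∈ Set.Icc (x 0) (x N),
          g (L i t) = (α i * (g t).1 + β i * (g t).2 + p i t, γ i * (g t).2 + q i t)) →
        Set.EqOn g f (Set.Icc (x 0) (x N)) := by
  have hI : ∀ i < N, i + 1 ∈ Set.Icc 1 N := fun i hi => ⟨by omega, hi⟩
  have hLc : ∀ i < N, ∀ t, L (i + 1) t = cellMap x N i t := fun i hi t => hL _ (hI i hi) t
  have hγ : ∀ i < N, |γ (i + 1)| < 1 := fun i hi =>
    (le_add_of_nonneg_left (abs_nonneg _)).trans_lt (hβγ _ (hI i hi))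
  have hα' : ∀ i < N, |α (i + 1)| < 1 := fun i hi => hα _ (hI i hi)
  obtain ⟨f₂, hf₂, hf₂eq, hf₂z⟩ := exists_selfReferential (w := z) (a := fun i => γ (i + 1))
    (r := fun i => q (i + 1)) hN hx hγ (fun i hi => hq _ (hI i hi))
    (fun i hi => (hmatch0 _ (hI i hi)).2) (fun i hi => (hmatchN _ (hI i hi)).2)
  obtain ⟨f₁, hf₁, hf₁eq, hf₁y⟩ := exists_selfReferential (w := y) (a := fun i => α (i + 1))
    (r := fun i t => β (i + 1) * f₂ t + p (i + 1) t) hN hx hα'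
    (fun i hi => (hf₂.const_mul _).continuousOn.add (hp _ (hI i hi)))
    (fun i hi => by
      simp only [hf₂z 0 N.zero_le, ← add_assoc]
      exact (hmatch0 _ (hI i hi)).1)
    (fun i hi => by
      simp only [hf₂z N le_rfl, ← add_assoc]
      exact (hmatchN _ (hI i hi)).1)
  refine ⟨fun t => (f₁ t, f₂ t), ⟨(hf₁.prodMk hf₂).continuousOn, ?_, ?_⟩, ?_⟩
  · rintro i hi t ht
    obtain ⟨i, rfl⟩ := Nat.exists_eq_add_of_le' hi.1
    simp only [hLc i hi.2, hf₁eq i hi.2 t ht, hf₂eq i hi.2 t ht, add_assoc]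
  · intro i hi
    simp only [hf₁y i hi, hf₂z i hi]
  · intro g hg hgeq
    have hg₂ : Set.EqOn (fun t => (g t).2) f₂ (Set.Icc (x 0) (x N)) :=
      eqOn_of_selfReferential hN hx hγ (continuous_snd.comp_continuousOn hg) hf₂.continuousOn
        (fun i hi t ht => by simp only [← hLc i hi, hgeq _ (hI i hi) t ht]) hf₂eq
    have hg₁ : Set.EqOn (fun t => (g t).1) f₁ (Set.Icc (x 0) (x N)) :=
      eqOn_of_selfReferential hN hx hα' (continuous_fst.comp_continuousOn hg) hf₁.continuousOn
        (fun i hi t ht => by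
          have h2 : (g t).2 = f₂ t := hg₂ ht
          simp only [← hLc i hi, hgeq _ (hI i hi) t ht, h2, add_assoc]) hf₁eq
    exact fun t ht => Prod.ext (hg₁ ht) (hg₂ ht)
end

section
/- If Θ < 1, Ω < 1 and Γ < 1, then f₁ ∈ Lip δ with δ = min(λ, μ), i.e. there exists C > 0 such that |f₁(x) − f₁(y)| ≤ C|x − y|^{min(λ,μ)} for all x, y ∈ [0,1]. -/
/-- Minimum of `g i` over `i = 1, …, N`. -/
noncomputable def minOver (N : ℕ) (g : ℕ → ℝ) : ℝ := sInf (g '' Set.Icc 1 N)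

/-- Maximum of `g i` over `i = 1, …, N`. -/
noncomputable def maxOver (N : ℕ) (g : ℕ → ℝ) : ℝ := sSup (g '' Set.Icc 1 N)

open Set Filter Topology

/-- A bounded quantity `G` that is either controlled by `d` or contracts, up to a multiple of `d`,
to its value at another point is controlled by `d`. -/
lemma exists_le_mul_of_contracting {ι : Type*} (S : Set ι) (G d : ι → ℝ) {D ρ B M : ℝ}
    (hρ0 : 0 ≤ ρ) (hρ : ρ < 1) (hd : ∀ z ∈ S, 0 ≤ d z) (hD0 : 0 ≤ D) (hD : ∀ z ∈ S, G z ≤ D)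
    (hstep : ∀ z ∈ S, G z ≤ B * d z ∨
      ∃ w ∈ S, ∃ a, 0 ≤ a ∧ a ≤ ρ ∧ G z ≤ a * G w + M * d z ∧ a * d w ≤ ρ * d z) :
    ∃ K ≥ 0, ∀ z ∈ S, G z ≤ K * d z := by
  set K := max 0 (max B (M / (1 - ρ))) with hK
  have hK0 : 0 ≤ K := le_max_left _ _
  have hKB : B ≤ K := (le_max_left _ _).trans (le_max_right _ _)
  have hKM : ρ * K + M ≤ K := by
    have h : M / (1 - ρ) ≤ K := (le_max_right _ _).trans (le_max_right _ _)
    rw [div_le_iff₀ (by linarith)] at h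
    linarith
  have key : ∀ n : ℕ, ∀ z ∈ S, G z ≤ K * d z + ρ ^ n * D := by
    intro n
    induction n with
    | zero =>
      intro z hz
      have := mul_nonneg hK0 (hd z hz)
      have := hD z hz
      simp only [pow_zero, one_mul]
      linarith
    | succ n ih =>
      intro z hz
      have hdz := hd z hz
      have hn : 0 ≤ ρ ^ n * D := by positivity
      rcases hstep z hz with h | ⟨w, hw, a, ha0, haρ, h, had⟩
      · have h1 := mul_le_mul_of_nonneg_right hKB hdz
        have h2 : 0 ≤ ρ ^ (n + 1) * D := by positivity
        linarith
      · have h1 := mul_le_mul_of_nonneg_left (ih w hw) ha0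
        have h2 := mul_le_mul_of_nonneg_right haρ hn
        have h3 := mul_le_mul_of_nonneg_left had hK0
        have h4 := mul_le_mul_of_nonneg_right hKM hdz
        rw [pow_succ]
        linarith
  refine ⟨K, hK0, fun z hz => ?_⟩
  have hlim : Tendsto (fun n : ℕ => K * d z + ρ ^ n * D) atTop (𝓝 (K * d z + 0 * D)) :=
    ((tendsto_pow_atTop_nhds_zero_of_lt_one hρ0 hρ).mul_const D).const_add _
  rw [zero_mul, add_zero] at hlim
  exact ge_of_tendsto' hlim fun n => key n z hz

/-- Every point of `[0, 1]` lies in one of the intervals of a partition of `[0, 1]`. -/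
lemma exists_mem_partition_interval {N : ℕ} {x : ℕ → ℝ} (hN : 1 ≤ N) (hx0 : x 0 = 0)
    (hxN : x N = 1) {s : ℝ} (hs : s ∈ Icc (0 : ℝ) 1) :
    ∃ i ∈ Icc 1 N, s ∈ Icc (x (i - 1)) (x i) := by
  classical
  have hex : ∃ n, 1 ≤ n ∧ s ≤ x n := ⟨N, hN, hxN ▸ hs.2⟩
  have hspec := Nat.find_spec hex
  refine ⟨Nat.find hex, ⟨hspec.1, Nat.find_min' hex ⟨hN, hxN ▸ hs.2⟩⟩, ?_, hspec.2⟩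
  by_contra! hlt
  rcases Nat.eq_zero_or_pos (Nat.find hex - 1) with h0 | hpos
  · rw [h0, hx0] at hlt
    linarith [hs.1]
  · exact Nat.find_min hex (by omega) ⟨hpos, hlt.le⟩

/-- A continuous solution of an affine self-referential equation with Hölder continuous
inhomogeneities is Hölder continuous of exponent `δ`, provided each `a i` is at most
`ρ * |I i| ^ δ` for a common `ρ < 1`. -/
lemma holder_of_self_referential {N : ℕ} (hN : 1 ≤ N) {x : ℕ → ℝ} (hx0 : x 0 = 0)
    (hxN : x N = 1) (hxmono : ∀ i < N, x i < x (i + 1)) {a : ℕ → ℝ} {r : ℕ → ℝ → ℝ}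
    {f : ℝ → ℝ} {δ ρ : ℝ} (hδ : 0 ≤ δ) (hρ : ρ < 1)
    (ha : ∀ i ∈ Icc 1 N, |a i| ≤ ρ * (x i - x (i - 1)) ^ δ)
    (hr : ∀ i ∈ Icc 1 N, ∃ M, ∀ s ∈ Icc (0 : ℝ) 1, ∀ t ∈ Icc (0 : ℝ) 1,
      |r i s - r i t| ≤ M * |s - t| ^ δ)
    (hf : ContinuousOn f (Icc 0 1))
    (heq : ∀ i ∈ Icc 1 N, ∀ t ∈ Icc (0 : ℝ) 1,
      f ((x i - x (i - 1)) * t + x (i - 1)) = a i * f t + r i t) :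
    ∃ C > 0, ∀ s ∈ Icc (0 : ℝ) 1, ∀ t ∈ Icc (0 : ℝ) 1, |f s - f t| ≤ C * |s - t| ^ δ := by
  have hmono : ∀ i j, i ≤ j → j ≤ N → x i ≤ x j := by
    intro i j hij
    induction j, hij using Nat.le_induction with
    | base => intro _; exact le_rfl
    | succ j _ ih => intro hj; exact (ih (by omega)).trans (hxmono j (by omega)).le
  have hx01 : ∀ i ≤ N, x i ∈ Icc (0 : ℝ) 1 := fun i hi =>
    ⟨hx0 ▸ hmono 0 i (Nat.zero_le _) hi, hxN ▸ hmono i N hi le_rfl⟩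
  have hlen : ∀ i ∈ Icc 1 N, 0 < x i - x (i - 1) := by
    intro i hi
    have := hxmono (i - 1) (by have := hi.1; have := hi.2; omega)
    rw [Nat.sub_add_cancel hi.1] at this
    linarith
  have hlen1 : ∀ i ∈ Icc 1 N, x i - x (i - 1) ≤ 1 := by
    intro i hi
    have h1 := (hx01 i hi.2).2
    have h2 := (hx01 (i - 1) ((Nat.sub_le _ _).trans hi.2)).1
    linarith
  have h1N : 1 ∈ Icc 1 N := ⟨le_rfl, hN⟩
  have hNN : N ∈ Icc 1 N := ⟨hN, le_rfl⟩
  obtain ⟨h, hh0, hh⟩ : ∃ h > 0, ∀ i ∈ Icc 1 N, h ≤ x i - x (i - 1) := by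
    obtain ⟨j, hj, hmin⟩ := exists_min_image (Icc 1 N) (fun i => x i - x (i - 1))
      (finite_Icc 1 N) ⟨1, h1N⟩
    exact ⟨_, hlen j hj, hmin⟩
  obtain ⟨M, hM0, hM⟩ : ∃ M ≥ 0, ∀ i ∈ Icc 1 N, ∀ s ∈ Icc (0 : ℝ) 1, ∀ t ∈ Icc (0 : ℝ) 1,
      |r i s - r i t| ≤ M * |s - t| ^ δ := by
    have hev : ∀ᶠ M in atTop, ∀ i ∈ Icc 1 N, ∀ s ∈ Icc (0 : ℝ) 1, ∀ t ∈ Icc (0 : ℝ) 1,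
        |r i s - r i t| ≤ M * |s - t| ^ δ := by
      rw [eventually_all_finite (finite_Icc 1 N)]
      intro i hi
      obtain ⟨m, hm⟩ := hr i hi
      filter_upwards [eventually_ge_atTop m] with M hmM s hs t ht
      exact (hm s hs t ht).trans (mul_le_mul_of_nonneg_right hmM (by positivity))
    obtain ⟨M, hM, hM0⟩ := (hev.and (eventually_ge_atTop 0)).exists
    exact ⟨M, hM0, hM⟩
  obtain ⟨D, hD0, hD⟩ : ∃ D ≥ 0, ∀ s ∈ Icc (0 : ℝ) 1, ∀ t ∈ Icc (0 : ℝ) 1, |f s - f t| ≤ D := by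
    obtain ⟨A, hA⟩ := isCompact_Icc.exists_bound_of_continuousOn hf
    have hA0 : 0 ≤ A := (norm_nonneg _).trans (hA 0 (by simp))
    refine ⟨A + A, by positivity, fun s hs t ht => ?_⟩
    exact (abs_sub _ _).trans (add_le_add (hA s hs) (hA t ht))
  have hρ0 : 0 ≤ ρ := by
    have h1 := (abs_nonneg _).trans (ha 1 h1N)
    exact nonneg_of_mul_nonneg_left h1 (Real.rpow_pos_of_pos (hlen 1 h1N) δ)
  have haρ : ∀ i ∈ Icc 1 N, |a i| ≤ ρ := fun i hi => (ha i hi).trans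
    (mul_le_of_le_one_right hρ0 (Real.rpow_le_one (hlen i hi).le (hlen1 i hi) hδ))
  have hhδ : 0 < h ^ δ := Real.rpow_pos_of_pos hh0 δ
  have hfar : ∀ s ∈ Icc (0 : ℝ) 1, ∀ t ∈ Icc (0 : ℝ) 1, h ≤ |s - t| →
      |f s - f t| ≤ D / h ^ δ * |s - t| ^ δ := by
    intro s hs t ht hst
    have h1 := mul_le_mul_of_nonneg_left (Real.rpow_le_rpow hh0.le hst hδ)
      (div_nonneg hD0 hhδ.le)
    rw [div_mul_cancel₀ _ hhδ.ne'] at h1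
    exact (hD s hs t ht).trans h1
  let u : ℕ → ℝ → ℝ := fun i s => (s - x (i - 1)) / (x i - x (i - 1))
  have hu : ∀ i ∈ Icc 1 N, ∀ s ∈ Icc (x (i - 1)) (x i), u i s ∈ Icc (0 : ℝ) 1 := by
    intro i hi s hs
    refine ⟨div_nonneg (by linarith [hs.1]) (hlen i hi).le, ?_⟩
    rw [div_le_one (hlen i hi)]
    linarith [hs.2]
  have hul : ∀ i, u i (x (i - 1)) = 0 := fun i => by simp [u]
  have hur : ∀ i ∈ Icc 1 N, u i (x i) = 1 := fun i hi => div_self (hlen i hi).ne'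
  have hfu : ∀ i ∈ Icc 1 N, ∀ s ∈ Icc (x (i - 1)) (x i),
      f s = a i * f (u i s) + r i (u i s) := by
    intro i hi s hs
    rw [← heq i hi _ (hu i hi s hs), mul_div_cancel₀ _ (hlen i hi).ne', sub_add_cancel]
  have hsame : ∀ i ∈ Icc 1 N, ∀ s ∈ Icc (x (i - 1)) (x i), ∀ t ∈ Icc (x (i - 1)) (x i),
      |f s - f t| ≤ |a i| * |f (u i s) - f (u i t)| + M / h ^ δ * |s - t| ^ δ ∧
      |a i| * |u i s - u i t| ^ δ ≤ ρ * |s - t| ^ δ := by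
    intro i hi s hs t ht
    have hl := hlen i hi
    have hdist : |s - t| ^ δ = (x i - x (i - 1)) ^ δ * |u i s - u i t| ^ δ := by
      rw [← Real.mul_rpow hl.le (abs_nonneg _)]
      congr 1
      nth_rw 1 [← abs_of_pos hl]
      rw [← abs_mul]
      congr 1
      simp only [u]
      field_simp
      ring
    have hnn : 0 ≤ |u i s - u i t| ^ δ := by positivity
    constructor
    · have h1 : |f s - f t| ≤ |a i| * |f (u i s) - f (u i t)| + |r i (u i s) - r i (u i t)| := by
        rw [hfu i hi s hs, hfu i hi t ht, ← abs_mul]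
        refine le_trans (le_of_eq ?_) (abs_add_le _ _)
        congr 1
        ring
      have h2 := hM i hi _ (hu i hi s hs) _ (hu i hi t ht)
      have h3 : M * |u i s - u i t| ^ δ ≤ M / h ^ δ * |s - t| ^ δ := by
        rw [hdist, div_mul_eq_mul_div, le_div_iff₀ hhδ, mul_assoc]
        refine mul_le_mul_of_nonneg_left ?_ hM0
        rw [mul_comm]
        exact mul_le_mul_of_nonneg_right (Real.rpow_le_rpow hh0.le (hh i hi) hδ) hnn
      linarith
    · rw [hdist, ← mul_assoc]
      exact mul_le_mul_of_nonneg_right (ha i hi) hnn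
  have h0mem : (0 : ℝ) ∈ Icc (0 : ℝ) 1 := by simp
  have h1mem : (1 : ℝ) ∈ Icc (0 : ℝ) 1 := by simp
  obtain ⟨A, hA0, hA⟩ : ∃ K ≥ 0, ∀ s ∈ Icc (0 : ℝ) 1, |f 0 - f s| ≤ K * |0 - s| ^ δ := by
    refine exists_le_mul_of_contracting (Icc (0 : ℝ) 1) (fun s => |f 0 - f s|)
      (fun s => |0 - s| ^ δ) (B := D / h ^ δ) (M := M / h ^ δ) hρ0 hρ
      (fun s _ => by positivity) hD0 (fun s hs => hD 0 h0mem s hs) fun s hs => ?_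
    have hx0' : x (1 - 1) = 0 := hx0
    by_cases hs1 : s ≤ x 1
    · right
      have hsI : s ∈ Icc (x (1 - 1)) (x 1) := ⟨hx0'.symm ▸ hs.1, hs1⟩
      have h0I : (0 : ℝ) ∈ Icc (x (1 - 1)) (x 1) := ⟨hx0'.le, hs.1.trans hs1⟩
      have hu0 : u 1 0 = 0 := by simpa only [hx0'] using hul 1
      have key := hsame 1 h1N 0 h0I s hsI
      rw [hu0] at key
      exact ⟨u 1 s, hu 1 h1N s hsI, |a 1|, abs_nonneg _, haρ 1 h1N, key⟩
    · left
      refine hfar 0 h0mem s hs ?_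
      have := hh 1 h1N
      rw [hx0'] at this
      rw [zero_sub, abs_neg, abs_of_nonneg hs.1]
      linarith
  obtain ⟨A', hA'0, hA'⟩ : ∃ K ≥ 0, ∀ s ∈ Icc (0 : ℝ) 1, |f s - f 1| ≤ K * |s - 1| ^ δ := by
    refine exists_le_mul_of_contracting (Icc (0 : ℝ) 1) (fun s => |f s - f 1|)
      (fun s => |s - 1| ^ δ) (B := D / h ^ δ) (M := M / h ^ δ) hρ0 hρ
      (fun s _ => by positivity) hD0 (fun s hs => hD s hs 1 h1mem) fun s hs => ?_
    by_cases hs1 : x (N - 1) ≤ s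
    · right
      have hsI : s ∈ Icc (x (N - 1)) (x N) := ⟨hs1, hxN.symm ▸ hs.2⟩
      have h1I : (1 : ℝ) ∈ Icc (x (N - 1)) (x N) := ⟨hs1.trans hs.2, hxN.ge⟩
      have hu1 : u N 1 = 1 := by simpa only [hxN] using hur N hNN
      have key := hsame N hNN s hsI 1 h1I
      rw [hu1] at key
      exact ⟨u N s, hu N hNN s hsI, |a N|, abs_nonneg _, haρ N hNN, key⟩
    · left
      refine hfar s hs 1 h1mem ?_
      have := hh N hNN
      rw [hxN] at this
      rw [abs_sub_comm, abs_of_nonneg (by linarith [hs.2])]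
      linarith
  obtain ⟨K, hK0, hK⟩ : ∃ K ≥ 0, ∀ z ∈ {z : ℝ × ℝ | 0 ≤ z.1 ∧ z.1 ≤ z.2 ∧ z.2 ≤ 1},
      |f z.1 - f z.2| ≤ K * |z.1 - z.2| ^ δ := by
    refine exists_le_mul_of_contracting _ (fun z : ℝ × ℝ => |f z.1 - f z.2|)
      (fun z => |z.1 - z.2| ^ δ) (D := D) (B := D / h ^ δ + (A + A' + 2 * (M / h ^ δ)))
      (M := M / h ^ δ) hρ0 hρ (fun z _ => by positivity) hD0
      (fun z hz => hD _ ⟨hz.1, hz.2.1.trans hz.2.2⟩ _ ⟨hz.1.trans hz.2.1, hz.2.2⟩) ?_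
    rintro ⟨s, t⟩ ⟨hs0, hst, ht1⟩
    dsimp only at hs0 hst ht1 ⊢
    have hs : s ∈ Icc (0 : ℝ) 1 := ⟨hs0, hst.trans ht1⟩
    have ht : t ∈ Icc (0 : ℝ) 1 := ⟨hs0.trans hst, ht1⟩
    obtain ⟨i, hi, hsi⟩ := exists_mem_partition_interval hN hx0 hxN hs
    have hnn : 0 ≤ |s - t| ^ δ := by positivity
    have hMh : 0 ≤ M / h ^ δ := div_nonneg hM0 hhδ.le
    have hDh : 0 ≤ D / h ^ δ := div_nonneg hD0 hhδ.le
    rcases le_or_gt t (x i) with hti | hti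
    · right
      have hti' : t ∈ Icc (x (i - 1)) (x i) := ⟨hsi.1.trans hst, hti⟩
      refine ⟨(u i s, u i t), ⟨(hu i hi s hsi).1, ?_, (hu i hi t hti').2⟩, |a i|, abs_nonneg _,
        haρ i hi, hsame i hi s hsi t hti'⟩
      exact div_le_div_of_nonneg_right (by linarith) (hlen i hi).le
    · left
      have hiN : i < N := by
        refine lt_of_le_of_ne hi.2 ?_
        rintro rfl
        linarith
      have hi' : i + 1 ∈ Icc 1 N := ⟨by omega, hiN⟩
      rcases le_or_gt t (x (i + 1)) with htj | htj
      · have htI : t ∈ Icc (x (i + 1 - 1)) (x (i + 1)) := ⟨hti.le, htj⟩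
        have hxI : x i ∈ Icc (x (i - 1)) (x i) := ⟨hsi.1.trans hsi.2, le_rfl⟩
        have hxJ : x i ∈ Icc (x (i + 1 - 1)) (x (i + 1)) := ⟨le_rfl, (hxmono i hiN).le⟩
        obtain ⟨hl1, hl2⟩ := hsame i hi s hsi (x i) hxI
        obtain ⟨hr1, hr2⟩ := hsame (i + 1) hi' (x i) hxJ t htI
        have hu0 : u (i + 1) (x i) = 0 := hul (i + 1)
        rw [hur i hi] at hl1 hl2
        rw [hu0] at hr1 hr2
        have hl3 := mul_le_mul_of_nonneg_left (hA' _ (hu i hi s hsi)) (abs_nonneg (a i))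
        have hr3 := mul_le_mul_of_nonneg_left (hA _ (hu (i + 1) hi' t htI))
          (abs_nonneg (a (i + 1)))
        have hdl : |s - x i| ^ δ ≤ |s - t| ^ δ := by
          refine Real.rpow_le_rpow (abs_nonneg _) ?_ hδ
          rw [abs_sub_comm, abs_of_nonneg (by linarith [hsi.2]), abs_sub_comm,
            abs_of_nonneg (by linarith)]
          linarith
        have hdr : |x i - t| ^ δ ≤ |s - t| ^ δ := by
          refine Real.rpow_le_rpow (abs_nonneg _) ?_ hδ
          rw [abs_sub_comm, abs_of_nonneg (by linarith), abs_sub_comm,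
            abs_of_nonneg (by linarith)]
          linarith [hsi.2]
        have hl4 : |a i| * |u i s - 1| ^ δ ≤ |s - t| ^ δ :=
          (hl2.trans (mul_le_of_le_one_left (by positivity) hρ.le)).trans hdl
        have hr4 : |a (i + 1)| * |0 - u (i + 1) t| ^ δ ≤ |s - t| ^ δ :=
          (hr2.trans (mul_le_of_le_one_left (by positivity) hρ.le)).trans hdr
        have hl5 := mul_le_mul_of_nonneg_left hl4 hA'0
        have hr5 := mul_le_mul_of_nonneg_left hr4 hA0
        have hl6 := mul_le_mul_of_nonneg_left hdl hMh
        have hr6 := mul_le_mul_of_nonneg_left hdr hMh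
        have htri := abs_sub_le (f s) (f (x i)) (f t)
        have hDnn := mul_nonneg hDh hnn
        linarith
      · have h1 := hfar s hs t ht (by
          have := hh (i + 1) hi'
          rw [Nat.add_sub_cancel] at this
          rw [abs_sub_comm, abs_of_nonneg (by linarith)]
          linarith [hsi.2])
        have h2 : 0 ≤ (A + A' + 2 * (M / h ^ δ)) * |s - t| ^ δ := by positivity
        linarith
  refine ⟨K + 1, by positivity, fun s hs t ht => ?_⟩
  have hnn : 0 ≤ |s - t| ^ δ := by positivity
  have hle : |f s - f t| ≤ K * |s - t| ^ δ := by
    rcases le_total s t with hst | hst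
    · exact hK (s, t) ⟨hs.1, hst, ht.2⟩
    · rw [abs_sub_comm (f s), abs_sub_comm s]
      exact hK (t, s) ⟨ht.1, hst, hs.2⟩
  linarith

lemma minOver_le {N i : ℕ} (g : ℕ → ℝ) (hi : i ∈ Icc 1 N) : minOver N g ≤ g i :=
  csInf_le ((finite_Icc 1 N).image g).bddBelow (mem_image_of_mem g hi)

lemma le_maxOver {N i : ℕ} (g : ℕ → ℝ) (hi : i ∈ Icc 1 N) : g i ≤ maxOver N g :=
  le_csSup ((finite_Icc 1 N).image g).bddAbove (mem_image_of_mem g hi)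

lemma minOver_nonneg {N : ℕ} {g : ℕ → ℝ} (hg : ∀ i ∈ Icc 1 N, 0 ≤ g i) : 0 ≤ minOver N g :=
  Real.sInf_nonneg (by rintro _ ⟨i, hi, rfl⟩; exact hg i hi)

/-- On `[0, 1]`, a Hölder bound of exponent `b` yields one of any smaller exponent `c ≥ 0`. -/
lemma holder_bound_of_le {g : ℝ → ℝ} {M b c : ℝ} (hM : 0 ≤ M) (hc : 0 ≤ c) (hcb : c ≤ b)
    (hg : ∀ s ∈ Icc (0 : ℝ) 1, ∀ t ∈ Icc (0 : ℝ) 1, |g s - g t| ≤ M * |s - t| ^ b) :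
    ∀ s ∈ Icc (0 : ℝ) 1, ∀ t ∈ Icc (0 : ℝ) 1, |g s - g t| ≤ M * |s - t| ^ c := by
  intro s hs t ht
  refine (hg s hs t ht).trans (mul_le_mul_of_nonneg_left ?_ hM)
  refine Real.rpow_le_rpow_of_exponent_ge_of_imp (abs_nonneg _) ?_ hcb ?_
  · rw [abs_le]
    constructor <;> linarith [hs.1, hs.2, ht.1, ht.2]
  · intro _ hb
    linarith

/-- If `Θ < 1`, `Ω < 1` and `Γ < 1`, then the CHFIF `f₁` is Lipschitz (Hölder) of
exponent `δ = min (λ, μ)`. -/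
theorem chfif_smoothness_theta_lt_one_omega_lt_one_gamma_lt_one
    (N : ℕ) (hN : 2 ≤ N)
    (x : ℕ → ℝ) (hx0 : x 0 = 0) (hxN : x N = 1)
    (hxmono : ∀ i < N, x i < x (i + 1))
    (α β γ : ℕ → ℝ)
    (hα : ∀ i ∈ Set.Icc 1 N, |α i| < 1)
    (hβγ : ∀ i ∈ Set.Icc 1 N, |β i| + |γ i| < 1)
    (lam mu : ℕ → ℝ)
    (hlam : ∀ i ∈ Set.Icc 1 N, lam i ∈ Set.Ioc (0 : ℝ) 1)
    (hmu : ∀ i ∈ Set.Icc 1 N, mu i ∈ Set.Ioc (0 : ℝ) 1)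
    (p q : ℕ → ℝ → ℝ)
    (hp : ∀ i ∈ Set.Icc 1 N, ∃ M > 0, ∀ s ∈ Set.Icc (0 : ℝ) 1, ∀ t ∈ Set.Icc (0 : ℝ) 1,
      |p i s - p i t| ≤ M * |s - t| ^ lam i)
    (hq : ∀ i ∈ Set.Icc 1 N, ∃ M > 0, ∀ s ∈ Set.Icc (0 : ℝ) 1, ∀ t ∈ Set.Icc (0 : ℝ) 1,
      |q i s - q i t| ≤ M * |s - t| ^ mu i)
    (f₁ f₂ : ℝ → ℝ)
    (hf₁c : ContinuousOn f₁ (Set.Icc 0 1)) (hf₂c : ContinuousOn f₂ (Set.Icc 0 1))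
    (heq₁ : ∀ i ∈ Set.Icc 1 N, ∀ t ∈ Set.Icc (0 : ℝ) 1,
      f₁ ((x i - x (i - 1)) * t + x (i - 1)) = α i * f₁ t + β i * f₂ t + p i t)
    (heq₂ : ∀ i ∈ Set.Icc 1 N, ∀ t ∈ Set.Icc (0 : ℝ) 1,
      f₂ ((x i - x (i - 1)) * t + x (i - 1)) = γ i * f₂ t + q i t)
    (hΘ : maxOver N (fun i => |α i| / (x i - x (i - 1)) ^ minOver N mu) < 1)
    (hΩ : maxOver N (fun i => |α i| / (x i - x (i - 1)) ^ minOver N lam) < 1)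
    (hΓ : maxOver N (fun i => |γ i| / (x i - x (i - 1)) ^ minOver N mu) < 1) :
    ∃ C > 0, ∀ s ∈ Set.Icc (0 : ℝ) 1, ∀ t ∈ Set.Icc (0 : ℝ) 1,
      |f₁ s - f₁ t| ≤ C * |s - t| ^ min (minOver N lam) (minOver N mu) := by
  have hN1 : 1 ≤ N := by omega
  have hlen : ∀ i ∈ Icc 1 N, 0 < x i - x (i - 1) := by
    intro i hi
    have := hxmono (i - 1) (by have := hi.1; have := hi.2; omega)
    rw [Nat.sub_add_cancel hi.1] at this
    linarith
  have hle : ∀ (a : ℕ → ℝ) (e : ℝ), ∀ i ∈ Icc 1 N,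
      |a i| ≤ maxOver N (fun i => |a i| / (x i - x (i - 1)) ^ e) * (x i - x (i - 1)) ^ e := by
    intro a e i hi
    rw [← div_le_iff₀ (Real.rpow_pos_of_pos (hlen i hi) e)]
    exact le_maxOver (fun i => |a i| / (x i - x (i - 1)) ^ e) hi
  have hmu0 : 0 ≤ minOver N mu := minOver_nonneg fun i hi => (hmu i hi).1.le
  have hlam0 : 0 ≤ minOver N lam := minOver_nonneg fun i hi => (hlam i hi).1.le
  set δ := min (minOver N lam) (minOver N mu) with hδ
  have hδ0 : 0 ≤ δ := le_min hlam0 hmu0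
  obtain ⟨C, hC0, hC⟩ := holder_of_self_referential hN1 hx0 hxN hxmono hmu0 hΓ (hle γ _)
    (fun i hi => by
      obtain ⟨M, hM0, hM⟩ := hq i hi
      exact ⟨M, holder_bound_of_le hM0.le hmu0 (minOver_le mu hi) hM⟩) hf₂c heq₂
  have hCδ := holder_bound_of_le hC0.le hδ0 (min_le_right _ _) hC
  obtain ⟨ρ, hρ, hαρ⟩ : ∃ ρ < 1, ∀ i ∈ Icc 1 N, |α i| ≤ ρ * (x i - x (i - 1)) ^ δ := by
    rcases min_choice (minOver N lam) (minOver N mu) with h | h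
    · exact ⟨_, hΩ, by rw [hδ, h]; exact hle α _⟩
    · exact ⟨_, hΘ, by rw [hδ, h]; exact hle α _⟩
  refine holder_of_self_referential (r := fun i t => β i * f₂ t + p i t) hN1 hx0 hxN hxmono hδ0
    hρ hαρ (fun i hi => ?_) hf₁c (fun i hi t ht => by rw [heq₁ i hi t ht, add_assoc])
  obtain ⟨M, hM0, hM⟩ := hp i hi
  refine ⟨|β i| * C + M, fun s hs t ht => ?_⟩
  have h1 := holder_bound_of_le hM0.le hδ0 ((min_le_left _ _).trans (minOver_le lam hi)) hM
    s hs t ht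
  have h2 := mul_le_mul_of_nonneg_left (hCδ s hs t ht) (abs_nonneg (β i))
  have h3 : |β i * f₂ s + p i s - (β i * f₂ t + p i t)| ≤
      |β i| * |f₂ s - f₂ t| + |p i s - p i t| := by
    rw [← abs_mul]
    refine le_trans (le_of_eq ?_) (abs_add_le _ _)
    congr 1
    ring
  linarith
end
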